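/- Let m, d be positive natural numbers and for each site s ∈ ℕ and index i ∈ {1, …, d} let A_i^[s] be an m × m complex matrix satisfying the consistency condition: for every n and every i ∈ {1, …, d}, ∑_{j=1}^{d} (A_j^[n+1])† (A_i^[n])† ⊗ A_i^[n] A_j^[n+1] = (A_i^[n])† ⊗ A_i^[n]. Then for every n and every k ≥ 1, ∑_{i_{n+1}, …, i_{n+k}} ((A_{i_{n+k}}^[n+k])† ⋯ (A_{i_{n+1}}^[n+1])†) ⊗ (A_{i_{n+1}}^[n+1] ⋯ A_{i_{n+k}}^[n+k]) = ∑_{i=1}^{d} (A_i^[n+1])† ⊗ A_i^[n+1], where ⊗ denotes the Kronecker product and † the conjugate transpose. -/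

import Mathlib

open Matrix Kronecker

lemma mps_key (m d : ℕ) (A : ℕ → Fin d → Matrix (Fin m) (Fin m) ℂ)
    (hcons : ∀ n : ℕ, ∀ i : Fin d,
      ∑ j : Fin d, ((A (n + 1) j)ᴴ * (A n i)ᴴ) ⊗ₖ (A n i * A (n + 1) j)
        = (A n i)ᴴ ⊗ₖ (A n i)) (n : ℕ) (i : Fin d) (Q : Matrix (Fin m) (Fin m) ℂ) :
    ∑ j : Fin d, (Q * A n i * A (n + 1) j)ᴴ ⊗ₖ (Q * A n i * A (n + 1) j)
      = (Q * A n i)ᴴ ⊗ₖ (Q * A n i) := by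
  have h := congrArg (fun X => ((1 : Matrix (Fin m) (Fin m) ℂ) ⊗ₖ Q) * X *
    (Qᴴ ⊗ₖ (1 : Matrix (Fin m) (Fin m) ℂ))) (hcons n i)
  simp only [Finset.mul_sum, Finset.sum_mul, ← Matrix.mul_kronecker_mul, Matrix.one_mul,
    Matrix.mul_one] at h
  simpa only [Matrix.conjTranspose_mul, Matrix.mul_assoc] using h

lemma mps_aux (m d : ℕ) (A : ℕ → Fin d → Matrix (Fin m) (Fin m) ℂ)
    (hcons : ∀ n : ℕ, ∀ i : Fin d,
      ∑ j : Fin d, ((A (n + 1) j)ᴴ * (A n i)ᴴ) ⊗ₖ (A n i * A (n + 1) j)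
        = (A n i)ᴴ ⊗ₖ (A n i)) (k : ℕ) : ∀ (n : ℕ) (Q : Matrix (Fin m) (Fin m) ℂ),
    ∑ i : Fin (k + 1) → Fin d,
        (Q * (List.ofFn fun t : Fin (k + 1) => A (n + t.val) (i t)).prod)ᴴ
          ⊗ₖ (Q * (List.ofFn fun t : Fin (k + 1) => A (n + t.val) (i t)).prod)
      = ∑ i : Fin d, (Q * A n i)ᴴ ⊗ₖ (Q * A n i) := by
  induction k with
  | zero =>
    intro n Q
    rw [← (Equiv.funUnique (Fin 1) (Fin d)).symm.sum_comp]
    simp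
  | succ k ih =>
    intro n Q
    rw [← (Fin.consEquiv fun _ : Fin (k + 2) => Fin d).sum_comp, Fintype.sum_prod_type]
    refine Finset.sum_congr rfl fun i _ => ?_
    rw [← mps_key m d A hcons n i Q, ← ih (n + 1) (Q * A n i)]
    refine Finset.sum_congr rfl fun f _ => ?_
    have e : (List.ofFn fun t : Fin (k + 1 + 1) => A (n + t.val)
        ((Fin.consEquiv fun _ : Fin (k + 2) => Fin d) (i, f) t)).prod
        = A n i * (List.ofFn fun t : Fin (k + 1) => A (n + 1 + t.val) (f t)).prod := by
      rw [List.ofFn_succ, List.prod_cons]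
      simp [Fin.consEquiv, Nat.add_assoc, Nat.add_comm 1]
    rw [e, Matrix.mul_assoc]

/-- under the consistency condition, the sum over all index sequences
`i_{n+1}, …, i_{n+k}` of `(A_{i_{n+k}}† ⋯ A_{i_{n+1}}†) ⊗ (A_{i_{n+1}} ⋯ A_{i_{n+k}})`
collapses to `∑ i, (A_i^[n+1])† ⊗ A_i^[n+1]`. -/
theorem mps_consistency_iterates
    (m d : ℕ) (hm : 0 < m) (hd : 0 < d)
    (A : ℕ → Fin d → Matrix (Fin m) (Fin m) ℂ)
    (hcons : ∀ n : ℕ, ∀ i : Fin d,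
      ∑ j : Fin d, ((A (n + 1) j)ᴴ * (A n i)ᴴ) ⊗ₖ (A n i * A (n + 1) j)
        = (A n i)ᴴ ⊗ₖ (A n i))
    (n k : ℕ) (hk : 1 ≤ k) :
    ∑ i : Fin k → Fin d,
        ((List.ofFn fun t : Fin k => A (n + 1 + t.val) (i t)).prod)ᴴ
          ⊗ₖ (List.ofFn fun t : Fin k => A (n + 1 + t.val) (i t)).prod
      = ∑ i : Fin d, (A (n + 1) i)ᴴ ⊗ₖ (A (n + 1) i) := by
  obtain ⟨k, rfl⟩ : ∃ l, k = l + 1 := ⟨k - 1, by omega⟩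
  simpa only [Matrix.one_mul] using mps_aux m d A hcons k (n + 1) 1
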